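/- For every c₀ > 0 there exists a constant c > 0 such that for all a ∈ ℝ, ∫_0^∞ ∫_0^∞ exp( 2(x + y) − 4a + c₀·((x − a)⁺)^{3/2} + c₀·((y − a)⁺)^{3/2} − (x + y)²/9 ) dx dy ≤ c·exp( c·(a⁻)^{3/2} ). -/

import Mathlib

open MeasureTheory

lemma rpow_three_halves_eq {t : ℝ} (ht : 0 ≤ t) :
    t ^ ((3 : ℝ) / 2) = √t ^ 3 := by
  rw [Real.sqrt_eq_rpow, ← Real.rpow_natCast, ← Real.rpow_mul ht]
  norm_num

lemma add_rpow_three_halves_le {x b : ℝ} (hx : 0 ≤ x) (hb : 0 ≤ b) :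
    (x + b) ^ ((3 : ℝ) / 2) ≤ 2 * (x ^ ((3 : ℝ) / 2) + b ^ ((3 : ℝ) / 2)) := by
  rw [rpow_three_halves_eq hx, rpow_three_halves_eq hb, rpow_three_halves_eq (add_nonneg hx hb)]
  have hu := Real.sqrt_nonneg x
  have hv := Real.sqrt_nonneg b
  have hw : √(x + b) ≤ √x + √b := by
    refine Real.sqrt_le_iff.2 ⟨add_nonneg hu hv, ?_⟩
    nlinarith [Real.sq_sqrt hx, Real.sq_sqrt hb, mul_nonneg hu hv]
  calc √(x + b) ^ 3 = (√x ^ 2 + √b ^ 2) * √(x + b) := by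
        rw [Real.sq_sqrt hx, Real.sq_sqrt hb, pow_succ, Real.sq_sqrt (add_nonneg hx hb)]
    _ ≤ (√x ^ 2 + √b ^ 2) * (√x + √b) := by gcongr
    _ ≤ 2 * (√x ^ 3 + √b ^ 3) := by
        nlinarith [mul_nonneg (add_nonneg hu hv) (sq_nonneg (√x - √b))]

lemma rpow_three_halves_posPart_sub_le {x : ℝ} (hx : 0 ≤ x) (a : ℝ) :
    (max (x - a) 0) ^ ((3 : ℝ) / 2) ≤
      2 * (x ^ ((3 : ℝ) / 2) + (max (-a) 0) ^ ((3 : ℝ) / 2)) := by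
  refine le_trans ?_ (add_rpow_three_halves_le hx (le_max_right (-a) 0))
  refine Real.rpow_le_rpow (le_max_right _ _) (max_le ?_ ?_) (by norm_num)
  · linarith [le_max_left (-a) 0]
  · linarith [le_max_right (-a) 0]

lemma le_one_add_rpow_three_halves {b : ℝ} (hb : 0 ≤ b) : b ≤ 1 + b ^ ((3 : ℝ) / 2) := by
  rcases le_total b 1 with h | h
  · linarith [Real.rpow_nonneg hb ((3 : ℝ) / 2)]
  · linarith [Real.self_le_rpow_of_one_le h (by norm_num : (1 : ℝ) ≤ 3 / 2)]

lemma two_mul_add_rpow_sub_sq_le (c₀ : ℝ) {x : ℝ} (hx : 0 ≤ x) :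
    2 * x + 2 * c₀ * x ^ ((3 : ℝ) / 2) - x ^ 2 / 9 ≤ 9 / 2 * (3 + 18 * c₀ ^ 2) ^ 2 - x := by
  rw [rpow_three_halves_eq hx]
  have hs : √x ^ 2 = x := Real.sq_sqrt hx
  have amgm : 2 * c₀ * √x ^ 3 ≤ x ^ 2 / 18 + 18 * c₀ ^ 2 * x := by
    rw [← hs, Real.sqrt_sq (Real.sqrt_nonneg x)]
    nlinarith [mul_nonneg (sq_nonneg (√x)) (sq_nonneg (√x - 18 * c₀))]
  nlinarith [sq_nonneg (x - 9 * (3 + 18 * c₀ ^ 2))]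

lemma lintegral_exp_neg_Ici_zero :
    ∫⁻ x in Set.Ici (0 : ℝ), ENNReal.ofReal (Real.exp (-x)) = 1 := by
  rw [setLIntegral_congr Ioi_ae_eq_Ici.symm, ← ofReal_integral_eq_lintegral_ofReal
    (integrableOn_exp_neg_Ioi 0) (ae_of_all _ fun x => (Real.exp_pos _).le),
    integral_exp_neg_Ioi_zero, ENNReal.ofReal_one]

/-- Double integral bound, quadrant part.
For every `c₀ > 0` there is `c > 0` such that for all `a ∈ ℝ`,
`∫_0^∞ ∫_0^∞ exp(2(x+y) − 4a + c₀ ((x−a)⁺)^{3/2} + c₀ ((y−a)⁺)^{3/2} − (x+y)²/9) dx dy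
  ≤ c exp(c (a⁻)^{3/2})`. -/
theorem double_integral_bound_quadrant
    (c₀ : ℝ) (hc₀ : 0 < c₀) :
    ∃ c : ℝ, 0 < c ∧ ∀ a : ℝ,
      (∫⁻ x in Set.Ici (0 : ℝ), ∫⁻ y in Set.Ici (0 : ℝ),
          ENNReal.ofReal (Real.exp (2 * (x + y) - 4 * a
            + c₀ * (max (x - a) 0) ^ ((3 : ℝ) / 2)
            + c₀ * (max (y - a) 0) ^ ((3 : ℝ) / 2) - (x + y) ^ 2 / 9))) ≤
        ENNReal.ofReal (c * Real.exp (c * (max (-a) 0) ^ ((3 : ℝ) / 2))) := by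
  set K : ℝ := 9 / 2 * (3 + 18 * c₀ ^ 2) ^ 2 with hK
  have hE : 0 < Real.exp (4 + 2 * K) := Real.exp_pos _
  refine ⟨Real.exp (4 + 2 * K) + (4 + 4 * c₀), by positivity, fun a => ?_⟩
  set b : ℝ := max (-a) 0 with hb
  have hb0 : 0 ≤ b := le_max_right _ _
  have hB : 0 ≤ b ^ ((3 : ℝ) / 2) := Real.rpow_nonneg hb0 _
  set C : ℝ := Real.exp (4 + 2 * K + (4 + 4 * c₀) * b ^ ((3 : ℝ) / 2)) with hC
  calc _ ≤ ∫⁻ x in Set.Ici (0 : ℝ), ∫⁻ y in Set.Ici (0 : ℝ),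
          ENNReal.ofReal C * ENNReal.ofReal (Real.exp (-x)) * ENNReal.ofReal (Real.exp (-y)) := by
        refine setLIntegral_mono' measurableSet_Ici fun x hx =>
          setLIntegral_mono' measurableSet_Ici fun y hy => ?_
        have hx0 : 0 ≤ x := hx
        have hy0 : 0 ≤ y := hy
        rw [← ENNReal.ofReal_mul (Real.exp_pos _).le, ← ENNReal.ofReal_mul (by positivity),
          ← Real.exp_add, ← Real.exp_add]
        refine ENNReal.ofReal_le_ofReal (Real.exp_le_exp.2 ?_)
        have hxa := mul_le_mul_of_nonneg_left (rpow_three_halves_posPart_sub_le hx0 a) hc₀.le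
        have hya := mul_le_mul_of_nonneg_left (rpow_three_halves_posPart_sub_le hy0 a) hc₀.le
        have hgx := two_mul_add_rpow_sub_sq_le c₀ hx0
        have hgy := two_mul_add_rpow_sub_sq_le c₀ hy0
        have hab : -a ≤ b := le_max_left _ _
        have hb1 := le_one_add_rpow_three_halves hb0
        rw [← hb] at hxa hya
        rw [← hK] at hgx hgy
        nlinarith [mul_nonneg hx0 hy0]
    _ = ENNReal.ofReal C := by
        simp_rw [lintegral_const_mul' _ _ (ENNReal.mul_ne_top ENNReal.ofReal_ne_top
          ENNReal.ofReal_ne_top), lintegral_exp_neg_Ici_zero, mul_one]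
        rw [lintegral_const_mul' _ _ ENNReal.ofReal_ne_top, lintegral_exp_neg_Ici_zero, mul_one]
    _ ≤ _ := by
        rw [hC, Real.exp_add]
        refine ENNReal.ofReal_le_ofReal (mul_le_mul (by linarith) (Real.exp_le_exp.2 ?_)
          (Real.exp_pos _).le (by positivity))
        exact mul_le_mul_of_nonneg_right (by linarith) hB
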